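/- Let z ≠ 0 be real and, on the open subset of ℝ⁴ where q_1 ≠ 0 and q_2 ≠ 0, define the Hamiltonian H_z^{MS} = ½ ( (sinh(z q_1²)/(z q_1²)) e^{z q_1²} e^{2 z q_2²} p_1² + (sinh(z q_2²)/(z q_2²)) e^{z q_2²} p_2² ) and the function I_z = (sinh(z q_1²)/(2 z q_1²)) e^{z q_1²} p_1². Then the canonical Poisson bracket {I_z, H_z^{MS}} vanishes identically, i.e. I_z is a constant of the motion for H_z^{MS}. -/

import Mathlib

open scoped BigOperators
open Real

noncomputable section

/-- Phase space ℝ^{2N} with canonical coordinates (q, p). -/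
abbrev Phase (N : ℕ) : Type := (Fin N → ℝ) × (Fin N → ℝ)

/-- The canonical Poisson bracket
`{f,g} = ∑ i, (∂f/∂q_i · ∂g/∂p_i − ∂g/∂q_i · ∂f/∂p_i)`. -/
noncomputable def pb {N : ℕ} (f g : Phase N → ℝ) (x : Phase N) : ℝ :=
  ∑ i : Fin N,
    ((fderiv ℝ f x) (Pi.single i 1, 0) * (fderiv ℝ g x) (0, Pi.single i 1)
      - (fderiv ℝ g x) (Pi.single i 1, 0) * (fderiv ℝ f x) (0, Pi.single i 1))

/-- The 2D maximally superintegrable Hamiltonian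
`H_z^{MS} = ½((sinh(zq₁²)/(zq₁²)) e^{zq₁²} e^{2zq₂²} p₁²
  + (sinh(zq₂²)/(zq₂²)) e^{zq₂²} p₂²)`. -/
noncomputable def Hms (z : ℝ) : Phase 2 → ℝ := fun x =>
  1 / 2 * (Real.sinh (z * (x.1 0) ^ 2) / (z * (x.1 0) ^ 2)
      * Real.exp (z * (x.1 0) ^ 2) * Real.exp (2 * z * (x.1 1) ^ 2) * (x.2 0) ^ 2
    + Real.sinh (z * (x.1 1) ^ 2) / (z * (x.1 1) ^ 2)
      * Real.exp (z * (x.1 1) ^ 2) * (x.2 1) ^ 2)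

/-- The additional integral `I_z = (sinh(zq₁²)/(2zq₁²)) e^{zq₁²} p₁²`. -/
noncomputable def Iz (z : ℝ) : Phase 2 → ℝ := fun x =>
  Real.sinh (z * (x.1 0) ^ 2) / (2 * z * (x.1 0) ^ 2)
    * Real.exp (z * (x.1 0) ^ 2) * (x.2 0) ^ 2

/-- The derivative of a function vanishes along every direction in which it is invariant. -/
theorem fderiv_apply_eq_zero_of_invariant {E : Type*} [NormedAddCommGroup E] [NormedSpace ℝ E]
    {f : E → ℝ} {v : E} (x : E) (h : ∀ t : ℝ, f (x + t • v) = f x) :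
    fderiv ℝ f x v = 0 := by
  by_cases hf : DifferentiableAt ℝ f x
  · rw [← hf.lineDeriv_eq_fderiv]
    simp [lineDeriv, h]
  · simp [fderiv_zero_of_not_differentiableAt hf]

/-- The part of `Hms` depending only on the second degree of freedom. -/
def HmsSecond (z : ℝ) : Phase 2 → ℝ := fun x =>
  1 / 2 * (Real.sinh (z * (x.1 1) ^ 2) / (z * (x.1 1) ^ 2)
    * Real.exp (z * (x.1 1) ^ 2) * (x.2 1) ^ 2)

theorem Hms_eq (z : ℝ) :
    Hms z = fun x => Iz z x * Real.exp (2 * z * (x.1 1) ^ 2) + HmsSecond z x := by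
  funext x
  have h : Real.sinh (z * (x.1 0) ^ 2) / (2 * z * (x.1 0) ^ 2)
      = 1 / 2 * (Real.sinh (z * (x.1 0) ^ 2) / (z * (x.1 0) ^ 2)) := by
    rw [mul_assoc, div_mul_div_comm, one_mul]
  simp only [Hms, Iz, HmsSecond, h]
  ring

theorem differentiableAt_Iz {z : ℝ} (hz : z ≠ 0) {x : Phase 2} (h : x.1 0 ≠ 0) :
    DifferentiableAt ℝ (Iz z) x := by
  have h0 : 2 * z * (x.1 0) ^ 2 ≠ 0 := by positivity
  unfold Iz
  fun_prop (disch := assumption)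

theorem differentiableAt_HmsSecond {z : ℝ} (hz : z ≠ 0) {x : Phase 2} (h : x.1 1 ≠ 0) :
    DifferentiableAt ℝ (HmsSecond z) x := by
  have h0 : z * (x.1 1) ^ 2 ≠ 0 := by positivity
  unfold HmsSecond
  fun_prop (disch := assumption)

theorem fderiv_Hms_apply {z : ℝ} (hz : z ≠ 0) {x : Phase 2} (h1 : x.1 0 ≠ 0) (h2 : x.1 1 ≠ 0)
    {v : Phase 2} (hv1 : v.1 1 = 0) (hv2 : v.2 1 = 0) :
    fderiv ℝ (Hms z) x v = Real.exp (2 * z * (x.1 1) ^ 2) * fderiv ℝ (Iz z) x v := by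
  have hI := differentiableAt_Iz hz h1
  have hE : DifferentiableAt ℝ (fun y : Phase 2 => Real.exp (2 * z * (y.1 1) ^ 2)) x := by
    fun_prop
  have hE0 : fderiv ℝ (fun y : Phase 2 => Real.exp (2 * z * (y.1 1) ^ 2)) x v = 0 :=
    fderiv_apply_eq_zero_of_invariant x fun t => by simp [hv1]
  have hK0 : fderiv ℝ (HmsSecond z) x v = 0 :=
    fderiv_apply_eq_zero_of_invariant x fun t => by simp [HmsSecond, hv1, hv2]
  rw [Hms_eq, fderiv_fun_add (hI.fun_mul hE) (differentiableAt_HmsSecond hz h2), fderiv_fun_mul hI hE]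
  simp [hE0, hK0]

theorem fderiv_Iz_apply_eq_zero (z : ℝ) (x : Phase 2) {v : Phase 2}
    (hv1 : v.1 0 = 0) (hv2 : v.2 0 = 0) : fderiv ℝ (Iz z) x v = 0 :=
  fderiv_apply_eq_zero_of_invariant x fun t => by simp [Iz, hv1, hv2]

/-- `{I_z, H_z^{MS}} = 0` on the open set where `q₁ ≠ 0` and
`q₂ ≠ 0`, i.e. `I_z` is a constant of the motion for `H_z^{MS}`. -/
theorem Iz_commutes_with_Hms (z : ℝ) (hz : z ≠ 0)
    (x : Phase 2) (h1 : x.1 0 ≠ 0) (h2 : x.1 1 ≠ 0) :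
    pb (Iz z) (Hms z) x = 0 := by
  rw [pb, Fin.sum_univ_two,
    fderiv_Hms_apply hz h1 h2 (v := (Pi.single 0 1, 0)) (by simp) (by simp),
    fderiv_Hms_apply hz h1 h2 (v := (0, Pi.single 0 1)) (by simp) (by simp),
    fderiv_Iz_apply_eq_zero z x (v := (Pi.single 1 1, 0)) (by simp) (by simp),
    fderiv_Iz_apply_eq_zero z x (v := (0, Pi.single 1 1)) (by simp) (by simp)]
  ring
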